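/- Let μ > 0 and ρ > 1 be real numbers and suppose μ̄ ≥ max{ 2·((𝔯−1)/𝔯)·(C_h^𝔯/(𝔯·log ρ))^{1/(𝔯−1)}, 2μ } + T^{−1/𝔯}·C_h. Then for every v₀ ∈ ℝ the function v(t) := exp(−μ̄·t + ∫_0^t |h(τ)| dτ)·v₀ (the solution of the linear ODE v̇ = −(μ̄ − |h|)·v with v(0) = v₀) satisfies |v(t)| ≤ ρ·e^{−μ(t−s)}·|v(s)| for all real t ≥ s ≥ 0. -/

import Mathlib

open MeasureTheory

/-- Young's inequality in tangent-line form: a power `x ^ r` with `r ≥ 1` lies above its tangent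
at `c`. -/
theorem le_tangent_rpow {r c x : ℝ} (hr : 1 ≤ r) (hc : 0 < c) (hx : 0 ≤ x) :
    x ≤ c / r / c ^ r * x ^ r + (r - 1) / r * c := by
  have hr0 : 0 < r := by linarith
  have hb := one_add_mul_self_le_rpow_one_add (s := x / c - 1)
    (by linarith [div_nonneg hx hc.le]) hr
  rw [add_sub_cancel, Real.div_rpow hx hc.le] at hb
  have hm := mul_le_mul_of_nonneg_left hb (div_pos hc hr0).le
  have hl : c / r * (1 + r * (x / c - 1)) = x - (r - 1) / r * c := by
    field_simp
    ring
  rw [hl] at hm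
  have hrw : c / r / c ^ r * x ^ r = c / r * (x ^ r / c ^ r) := by ring
  linarith

theorem intervalIntegrable_abs_of_rpow {h : ℝ → ℝ} {r a b : ℝ} (hr : 1 ≤ r)
    (hmeas : Measurable h)
    (hint : IntervalIntegrable (fun τ => |h τ| ^ r) volume a b) :
    IntervalIntegrable (fun τ => |h τ|) volume a b := by
  have hg : IntervalIntegrable (fun τ => 1 / r / 1 ^ r * |h τ| ^ r + (r - 1) / r * 1)
      volume a b := (hint.const_mul _).add intervalIntegrable_const
  refine hg.mono_fun hmeas.abs.aestronglyMeasurable (Filter.Eventually.of_forall fun τ => ?_)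
  have hle := le_tangent_rpow hr one_pos (abs_nonneg (h τ))
  simp only [Real.norm_eq_abs, abs_abs]
  exact hle.trans (le_abs_self _)

/-- Integrated form of `le_tangent_rpow`. -/
theorem integral_abs_le_tangent {h : ℝ → ℝ} {r a b c A : ℝ} (hr : 1 ≤ r) (hc : 0 < c)
    (hab : a ≤ b) (hmeas : Measurable h)
    (hint : IntervalIntegrable (fun τ => |h τ| ^ r) volume a b)
    (hA : (∫ τ in a..b, |h τ| ^ r) ≤ A) :
    (∫ τ in a..b, |h τ|) ≤ c / r / c ^ r * A + (r - 1) / r * c * (b - a) := by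
  have hr0 : 0 < r := by linarith
  calc (∫ τ in a..b, |h τ|)
      ≤ ∫ τ in a..b, (c / r / c ^ r * |h τ| ^ r + (r - 1) / r * c) :=
        intervalIntegral.integral_mono_on hab
          (intervalIntegrable_abs_of_rpow hr hmeas hint)
          ((hint.const_mul _).add intervalIntegrable_const)
          fun τ _ => le_tangent_rpow hr hc (abs_nonneg _)
    _ = c / r / c ^ r * (∫ τ in a..b, |h τ| ^ r) + (r - 1) / r * c * (b - a) := by
        rw [intervalIntegral.integral_add (hint.const_mul _) intervalIntegrable_const,
          intervalIntegral.integral_const_mul, intervalIntegral.integral_const, smul_eq_mul]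
        ring
    _ ≤ _ := by gcongr

/-- Proposition `ode-stab0`: if
`μ̄ ≥ max{2((r-1)/r)(C_h^r/(r log ρ))^(1/(r-1)), 2μ} + T^(-1/r) C_h`, then
`v(t) := exp(-μ̄ t + ∫_0^t |h|) v₀` satisfies `|v(t)| ≤ ρ e^{-μ(t-s)} |v(s)|`
for all `t ≥ s ≥ 0`. -/
theorem stmt_3 (T Ch r : ℝ) (hT : 0 < T) (hCh : 0 < Ch) (hr : 1 < r)
    (h : ℝ → ℝ) (hmeas : Measurable h)
    (hloc : ∀ a b : ℝ, 0 ≤ a → IntegrableOn (fun τ => |h τ| ^ r) (Set.Icc a b))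
    (hbound : ∀ s : ℝ, 0 ≤ s → (∫ τ in s..(s + T), |h τ| ^ r) ≤ Ch ^ r)
    (μ ρ μbar : ℝ) (hμ : 0 < μ) (hρ : 1 < ρ)
    (hμbar : max (2 * ((r - 1) / r) * (Ch ^ r / (r * Real.log ρ)) ^ (1 / (r - 1))) (2 * μ) +
        T ^ (-1 / r) * Ch ≤ μbar) :
    ∀ v₀ : ℝ, ∀ s t : ℝ, 0 ≤ s → s ≤ t →
      |Real.exp (-μbar * t + ∫ τ in (0:ℝ)..t, |h τ|) * v₀| ≤
        ρ * Real.exp (-μ * (t - s)) *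
          |Real.exp (-μbar * s + ∫ τ in (0:ℝ)..s, |h τ|) * v₀| := by
  intro v₀ s t hs hst
  have hr0 : 0 < r := by linarith
  have hr1 : 0 < r - 1 := by linarith
  have hlog : 0 < Real.log ρ := Real.log_pos hρ
  have hChr : 0 < Ch ^ r := Real.rpow_pos_of_pos hCh r
  have hintr : ∀ a b : ℝ, 0 ≤ a → a ≤ b →
      IntervalIntegrable (fun τ => |h τ| ^ r) volume a b := fun a b ha hab =>
    (intervalIntegrable_iff_integrableOn_Icc_of_le hab).2 (hloc a b ha)
  have hint : ∀ a b : ℝ, 0 ≤ a → a ≤ b → IntervalIntegrable (fun τ => |h τ|) volume a b :=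
    fun a b ha hab => intervalIntegrable_abs_of_rpow hr.le hmeas (hintr a b ha hab)
  set M := T ^ (-1 / r) * Ch with hM
  have hM0 : 0 < M := mul_pos (Real.rpow_pos_of_pos hT _) hCh
  have hMr : M ^ r = Ch ^ r / T := by
    rw [hM, Real.mul_rpow (Real.rpow_nonneg hT.le _) hCh.le, ← Real.rpow_mul hT.le,
      div_mul_cancel₀ _ hr0.ne', Real.rpow_neg_one]
    field_simp
  have hperiod : ∀ a : ℝ, 0 ≤ a → (∫ τ in a..(a + T), |h τ|) ≤ T * M := fun a ha => by
    have hle := integral_abs_le_tangent hr.le hM0 (by linarith) hmeas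
      (hintr a (a + T) ha (by linarith)) (hbound a ha)
    have heq : M / r / M ^ r * Ch ^ r + (r - 1) / r * M * (a + T - a) = T * M := by
      rw [hMr]
      field_simp
      ring
    rwa [heq] at hle
  have hperiods : ∀ n : ℕ, (∫ τ in s..(s + n * T), |h τ|) ≤ n * T * M := fun n => by
    induction n with
    | zero => simp
    | succ n ih =>
      have hn : 0 ≤ n * T := by positivity
      have hstep := hperiod (s + n * T) (by linarith)
      have hsum := intervalIntegral.integral_add_adjacent_intervals
        (hint s (s + n * T) hs (by linarith))
        (hint (s + n * T) (s + n * T + T) (by linarith) (by linarith))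
      have he : s + ((n + 1 : ℕ) : ℝ) * T = s + n * T + T := by push_cast; ring
      rw [he, ← hsum]
      push_cast
      linarith
  set c := (Ch ^ r / (r * Real.log ρ)) ^ (1 / (r - 1)) with hc
  have hc0 : 0 < c := Real.rpow_pos_of_pos (by positivity) _
  have hcr : c ^ r = Ch ^ r / (r * Real.log ρ) * c := by
    have hpow : c ^ (r - 1) = Ch ^ r / (r * Real.log ρ) := by
      rw [hc, ← Real.rpow_mul (by positivity), one_div_mul_cancel hr1.ne', Real.rpow_one]
    rw [← hpow, Real.rpow_sub_one hc0.ne', div_mul_cancel₀ _ hc0.ne']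
  set n := ⌊(t - s) / T⌋₊
  have hn_le : n * T ≤ t - s :=
    (le_div_iff₀ hT).1 (Nat.floor_le (div_nonneg (by linarith) hT.le))
  have hn_lt : t - s < (n + 1) * T := (div_lt_iff₀ hT).1 (Nat.lt_floor_add_one _)
  have hn0 : 0 ≤ n * T := by positivity
  have hremr : (∫ τ in (s + n * T)..t, |h τ| ^ r) ≤ Ch ^ r := by
    refine le_trans ?_ (hbound (s + n * T) (by linarith))
    exact intervalIntegral.integral_mono_interval le_rfl (by linarith) (by linarith)
      (Filter.Eventually.of_forall fun τ => Real.rpow_nonneg (abs_nonneg _) _)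
      (hintr _ _ (by linarith) (by linarith))
  have hrem := integral_abs_le_tangent hr.le hc0 (by linarith) hmeas
    (hintr (s + n * T) t (by linarith) (by linarith)) hremr
  have hcoef : c / r / c ^ r * Ch ^ r = Real.log ρ := by
    rw [hcr]
    field_simp
  rw [hcoef] at hrem
  have hsplit := intervalIntegral.integral_add_adjacent_intervals
    (hint s (s + n * T) hs (by linarith)) (hint (s + n * T) t (by linarith) (by linarith))
  have hsplit' := intervalIntegral.integral_add_adjacent_intervals
    (hint 0 s le_rfl hs) (hint s t hs hst)
  have hK : (r - 1) / r * c + μ + M ≤ μbar := by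
    have h1 := le_max_left (2 * ((r - 1) / r) * c) (2 * μ)
    have h2 := le_max_right (2 * ((r - 1) / r) * c) (2 * μ)
    linarith
  have hKnn : 0 ≤ (r - 1) / r * c := by positivity
  have hmain : (∫ τ in s..t, |h τ|) ≤ Real.log ρ + (μbar - μ) * (t - s) := by
    have h1 : (r - 1) / r * c * (t - (s + n * T)) ≤ (r - 1) / r * c * (t - s) :=
      mul_le_mul_of_nonneg_left (by linarith) hKnn
    have h2 : n * T * M ≤ (t - s) * M := mul_le_mul_of_nonneg_right hn_le hM0.le
    have h3 : ((r - 1) / r * c + M) * (t - s) ≤ (μbar - μ) * (t - s) :=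
      mul_le_mul_of_nonneg_right (by linarith) (by linarith)
    linarith [hperiods n]
  rw [abs_mul, abs_mul, Real.abs_exp, Real.abs_exp, ← mul_assoc]
  refine mul_le_mul_of_nonneg_right ?_ (abs_nonneg _)
  nth_rewrite 1 [← Real.exp_log (zero_lt_one.trans hρ)]
  rw [← Real.exp_add, ← Real.exp_add, Real.exp_le_exp, ← hsplit']
  linarith
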